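/- Let α ∈ (1,∞), let 𝒞 be a finite alphabet, f ∈ ℝ^𝒞, and let p be a probability distribution on A×C×B×E (finite sets, C taking values in 𝒞). For a probability distribution q on B with supp(p_B) ⊆ supp(q), define the weight σ_q(b,e) := q(b)·p_{E|B}(e|b) on B×E. Then sup over all such q of H_α^f(AC|BE)_{p|σ_q} = (α/(1−α))·log( Σ_b p_B(b)·( Σ_c p_{C|B}(c|b)^α · 2^{(α−1)·[D_α(p_{AE|C=c,B=b} ‖ 1_A⊗p_{E|B=b}) + f_c]} )^{1/α} ), where p_{E|B=b}(e) = Σ_c p_{C|B}(c|b)·p_{E|CB}(e|c,b) and the supremum is attained. -/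

import Mathlib

/-- Classical Rényi divergence of order `α` between a distribution `p` and a
nonnegative weight `q` on the same finite set:
`D_α(p‖q) = (1/(α−1))·log(Σ_x p(x)^α·q(x)^{1−α})`. -/
noncomputable def Dalpha (α : ℝ) {X : Type} [Fintype X] (p q : X → ℝ) : ℝ :=
  (1 / (α - 1)) * Real.logb 2 (∑ x, p x ^ α * q x ^ (1 - α))

/-- Classical `f`-weighted Rényi entropy `H_α^f(AC|BE)_{p|σ}` of a joint distribution
`p` on `A × C × B × E` relative to a weight `σ` on `B × E`:
`H_α^f(AC|BE)_{p|σ} = (1/(1−α))·log(Σ_c p_C(c)^α·2^{(α−1)·[f_c + D_α(p_{ABE|C=c} ‖ 1_A⊗σ)]})`. -/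
noncomputable def Hf (α : ℝ) {A C B E : Type} [Fintype A] [Fintype C] [Fintype B] [Fintype E]
    (f : C → ℝ) (p : A → C → B → E → ℝ) (σ : B → E → ℝ) : ℝ :=
  (1 / (1 - α)) * Real.logb 2
    (∑ c, (∑ a, ∑ b, ∑ e, p a c b e) ^ α *
      (2 : ℝ) ^ ((α - 1) * (f c +
        Dalpha α (fun x : A × B × E => p x.1 c x.2.1 x.2.2 / (∑ a, ∑ b, ∑ e, p a c b e))
          (fun x : A × B × E => σ x.2.1 x.2.2))))

/-- Multiplying `2^{(α-1) D_α}` of a normalized weight by the `α`-th power of its total mass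
undoes the normalization. -/
theorem mass_rpow_mul_two_rpow_Dalpha {α : ℝ} (hα : 1 < α) {X : Type} [Fintype X]
    {p σ : X → ℝ} (hp : ∀ x, 0 ≤ p x) (hσ : ∀ x, 0 ≤ σ x) (hsupp : ∀ x, p x ≠ 0 → σ x ≠ 0)
    {s : ℝ} (hs : s = ∑ x, p x) :
    s ^ α * (2 : ℝ) ^ ((α - 1) * Dalpha α (fun x => p x / s) σ) =
      ∑ x, p x ^ α * σ x ^ (1 - α) := by
  have hs0 : 0 ≤ s := hs ▸ Finset.sum_nonneg fun x _ => hp x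
  have hα0 : α ≠ 0 := by linarith
  rcases hs0.eq_or_lt with h | h
  · have hz : ∀ x, p x = 0 := fun x =>
      (Finset.sum_eq_zero_iff_of_nonneg fun x _ => hp x).1 (hs.symm.trans h.symm) x
        (Finset.mem_univ x)
    simp [hz, ← h, Real.zero_rpow hα0]
  · obtain ⟨x, -, hx⟩ : ∃ x ∈ Finset.univ, p x ≠ 0 :=
      Finset.exists_ne_zero_of_sum_ne_zero (hs ▸ h.ne')
    have hpos : 0 < ∑ x, (p x / s) ^ α * σ x ^ (1 - α) := by
      refine Finset.sum_pos' (fun y _ => ?_) ⟨x, Finset.mem_univ x, ?_⟩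
      · exact mul_nonneg (Real.rpow_nonneg (div_nonneg (hp y) hs0) _)
          (Real.rpow_nonneg (hσ y) _)
      · exact mul_pos (Real.rpow_pos_of_pos (div_pos ((hp x).lt_of_ne' hx) h) _)
          (Real.rpow_pos_of_pos ((hσ x).lt_of_ne' (hsupp x hx)) _)
    have hD : (α - 1) * Dalpha α (fun x => p x / s) σ =
        Real.logb 2 (∑ x, (p x / s) ^ α * σ x ^ (1 - α)) := by
      have : α - 1 ≠ 0 := by linarith
      unfold Dalpha
      field_simp
    rw [hD, Real.rpow_logb (by norm_num) (by norm_num) hpos, Finset.mul_sum]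
    refine Finset.sum_congr rfl fun y _ => ?_
    rw [Real.div_rpow (hp y) hs0]
    have : s ^ α ≠ 0 := (Real.rpow_pos_of_pos h _).ne'
    field_simp

/-- A weighted power-mean inequality, the lower bound in the minimization of
`∑ q^{1-α} S` over probability vectors `q`. -/
theorem sum_rpow_inv_rpow_le {α : ℝ} (hα : 1 < α) {B : Type} [Fintype B] {q S : B → ℝ}
    (hq : ∀ b, 0 ≤ q b) (hq1 : ∑ b, q b = 1) (hS : ∀ b, 0 ≤ S b)
    (hsupp : ∀ b, S b ≠ 0 → q b ≠ 0) :
    (∑ b, S b ^ (1 / α)) ^ α ≤ ∑ b, q b ^ (1 - α) * S b := by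
  have hα0 : α ≠ 0 := by linarith
  have key := Real.rpow_arith_mean_le_arith_mean_rpow Finset.univ q
    (fun b => S b ^ (1 / α) / q b) (fun b _ => hq b) hq1
    (fun b _ => div_nonneg (Real.rpow_nonneg (hS b) _) (hq b)) hα.le
  convert key using 2
  · refine Finset.sum_congr rfl fun b _ => ?_
    by_cases h : S b = 0
    · simp [h, Real.zero_rpow (inv_ne_zero hα0)]
    · have := hsupp b h
      field_simp
  · rename_i b _
    by_cases h : S b = 0
    · simp [h, Real.zero_rpow (inv_ne_zero hα0), Real.zero_rpow hα0]
    · have hb := hsupp b h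
      rw [Real.div_rpow (Real.rpow_nonneg (hS b) _) (hq b), ← Real.rpow_mul (hS b),
        one_div_mul_cancel hα0, Real.rpow_one, Real.rpow_sub ((hq b).lt_of_ne' hb),
        Real.rpow_one]
      ring

/-- The bound `sum_rpow_inv_rpow_le` is attained at `q` proportional to `S^{1/α}`. -/
theorem sum_normalized_rpow_mul {α : ℝ} (hα : 1 < α) {B : Type} [Fintype B] {S : B → ℝ}
    (hS : ∀ b, 0 ≤ S b) (hZ : 0 < ∑ b, S b ^ (1 / α)) :
    ∑ b, (S b ^ (1 / α) / ∑ b', S b' ^ (1 / α)) ^ (1 - α) * S b =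
      (∑ b, S b ^ (1 / α)) ^ α := by
  have hα0 : α ≠ 0 := by linarith
  set Z := ∑ b, S b ^ (1 / α) with hZdef
  have : Z ^ α = ∑ b, Z ^ (α - 1) * S b ^ (1 / α) := by
    rw [← Finset.mul_sum, ← hZdef, Real.rpow_sub_one hZ.ne', div_mul_cancel₀ _ hZ.ne']
  rw [this]
  refine Finset.sum_congr rfl fun b _ => ?_
  rcases (hS b).eq_or_lt with h | h
  · rw [← h, Real.zero_rpow (one_div_ne_zero hα0)]
    simp
  · rw [Real.div_rpow (Real.rpow_nonneg (hS b) _) hZ.le, ← Real.rpow_mul (hS b),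
      show (1 - α : ℝ) = -(α - 1) by ring, Real.rpow_neg hZ.le, div_inv_eq_mul,
      mul_comm _ (Z ^ _), mul_assoc]
    congr 1
    nth_rewrite 2 [← Real.rpow_one (S b)]
    rw [← Real.rpow_add h]
    congr 1
    field_simp
    ring

/-- The quantity `∑_{a,c,e} 2^{(α-1) f_c} p(a,c,b,e)^α p_{E|B}(e|b)^{1-α}` at a fixed `b`. -/
noncomputable def blockSum (α : ℝ) {A C B E : Type} [Fintype A] [Fintype C] [Fintype E]
    (f : C → ℝ) (p : A → C → B → E → ℝ) (b : B) : ℝ :=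
  ∑ c, (2 : ℝ) ^ ((α - 1) * f c) * ∑ a, ∑ e, p a c b e ^ α *
    ((∑ a, ∑ c, p a c b e) / (∑ a, ∑ c, ∑ e', p a c b e')) ^ (1 - α)

section
variable {A C B E : Type} [Fintype A] [Fintype C] {p : A → C → B → E → ℝ}

theorem marginal_BE_ne_zero (hp0 : ∀ a c b e, 0 ≤ p a c b e) {a : A} {c : C} {b : B} {e : E}
    (h : p a c b e ≠ 0) : ∑ a, ∑ c, p a c b e ≠ 0 := by
  intro h0
  rw [Finset.sum_eq_zero_iff_of_nonneg
    fun a _ => Finset.sum_nonneg fun c _ => hp0 a c b e] at h0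
  have h1 := h0 a (Finset.mem_univ a)
  rw [Finset.sum_eq_zero_iff_of_nonneg fun c _ => hp0 a c b e] at h1
  exact h (h1 c (Finset.mem_univ c))

variable [Fintype E]

theorem marginal_B_nonneg (hp0 : ∀ a c b e, 0 ≤ p a c b e) (b : B) :
    0 ≤ ∑ a, ∑ c, ∑ e, p a c b e :=
  Finset.sum_nonneg fun a _ => Finset.sum_nonneg fun c _ => Finset.sum_nonneg fun e _ =>
    hp0 a c b e

theorem marginal_B_ne_zero (hp0 : ∀ a c b e, 0 ≤ p a c b e) {a : A} {c : C} {b : B} {e : E}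
    (h : p a c b e ≠ 0) : ∑ a, ∑ c, ∑ e, p a c b e ≠ 0 := by
  intro h0
  rw [Finset.sum_eq_zero_iff_of_nonneg fun a _ => Finset.sum_nonneg fun c _ =>
    Finset.sum_nonneg fun e _ => hp0 a c b e] at h0
  have h1 := h0 a (Finset.mem_univ a)
  rw [Finset.sum_eq_zero_iff_of_nonneg fun c _ => Finset.sum_nonneg fun e _ => hp0 a c b e] at h1
  have h2 := h1 c (Finset.mem_univ c)
  rw [Finset.sum_eq_zero_iff_of_nonneg fun e _ => hp0 a c b e] at h2
  exact h (h2 e (Finset.mem_univ e))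

theorem exists_ne_zero_of_marginal_B_ne_zero {b : B}
    (h : ∑ a, ∑ c, ∑ e, p a c b e ≠ 0) : ∃ a c e, p a c b e ≠ 0 := by
  contrapose! h
  simp [h]

theorem conditional_nonneg (hp0 : ∀ a c b e, 0 ≤ p a c b e) (b : B) (e : E) :
    0 ≤ (∑ a, ∑ c, p a c b e) / (∑ a, ∑ c, ∑ e', p a c b e') :=
  div_nonneg (Finset.sum_nonneg fun a _ => Finset.sum_nonneg fun c _ => hp0 a c b e)
    (marginal_B_nonneg hp0 b)

theorem blockSum_nonneg (hp0 : ∀ a c b e, 0 ≤ p a c b e) (α : ℝ) (f : C → ℝ) (b : B) :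
    0 ≤ blockSum α f p b :=
  Finset.sum_nonneg fun c _ => mul_nonneg (by positivity) <|
    Finset.sum_nonneg fun a _ => Finset.sum_nonneg fun e _ =>
      mul_nonneg (Real.rpow_nonneg (hp0 a c b e) _)
        (Real.rpow_nonneg (conditional_nonneg hp0 b e) _)

theorem blockSum_ne_zero_iff (hp0 : ∀ a c b e, 0 ≤ p a c b e) {α : ℝ} (hα : 1 < α)
    (f : C → ℝ) (b : B) : blockSum α f p b ≠ 0 ↔ ∑ a, ∑ c, ∑ e, p a c b e ≠ 0 := by
  have hα0 : α ≠ 0 := by linarith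
  constructor
  · intro h hb
    refine h ?_
    have hz : ∀ a c e, p a c b e = 0 := fun a c e => by
      by_contra h'
      exact marginal_B_ne_zero hp0 h' hb
    simp [blockSum, hz, Real.zero_rpow hα0]
  · intro h
    obtain ⟨a, c, e, hne⟩ := exists_ne_zero_of_marginal_B_ne_zero h
    have hterm : ∀ a c e, 0 ≤ p a c b e ^ α *
        ((∑ a, ∑ c, p a c b e) / (∑ a, ∑ c, ∑ e', p a c b e')) ^ (1 - α) := fun a c e =>
      mul_nonneg (Real.rpow_nonneg (hp0 a c b e) _)
        (Real.rpow_nonneg (conditional_nonneg hp0 b e) _)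
    refine (Finset.sum_pos' (fun c _ => mul_nonneg (by positivity) <|
      Finset.sum_nonneg fun a _ => Finset.sum_nonneg fun e _ => hterm a c e)
      ⟨c, Finset.mem_univ c, mul_pos (by positivity) ?_⟩).ne'
    refine Finset.sum_pos' (fun a _ => Finset.sum_nonneg fun e _ => hterm a c e)
      ⟨a, Finset.mem_univ a, Finset.sum_pos' (fun e _ => hterm a c e)
        ⟨e, Finset.mem_univ e, ?_⟩⟩
    exact mul_pos (Real.rpow_pos_of_pos ((hp0 a c b e).lt_of_ne' hne) _)
      (Real.rpow_pos_of_pos ((conditional_nonneg hp0 b e).lt_of_ne'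
        (div_ne_zero (marginal_BE_ne_zero hp0 hne) h)) _)

/-- The `f`-weighted entropy relative to `q(b) p_{E|B}(e|b)` in terms of `blockSum`. -/
theorem Hf_eq_logb_sum_blockSum [Fintype B] (hp0 : ∀ a c b e, 0 ≤ p a c b e) {α : ℝ}
    (hα : 1 < α) (f : C → ℝ) {q : B → ℝ} (hq : ∀ b, 0 ≤ q b)
    (hsupp : ∀ b, (∑ a, ∑ c, ∑ e, p a c b e) ≠ 0 → q b ≠ 0) :
    Hf α f p (fun b e => q b * ((∑ a, ∑ c, p a c b e) / (∑ a, ∑ c, ∑ e', p a c b e'))) =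
      (1 / (1 - α)) * Real.logb 2 (∑ b, q b ^ (1 - α) * blockSum α f p b) := by
  unfold Hf
  congr 2
  simp only [blockSum, Finset.mul_sum]
  rw [Finset.sum_comm]
  refine Finset.sum_congr rfl fun c _ => ?_
  rw [mul_add, Real.rpow_add two_pos, mul_left_comm,
    mass_rpow_mul_two_rpow_Dalpha hα (p := fun x : A × B × E => p x.1 c x.2.1 x.2.2)
      (fun x => hp0 _ _ _ _) (fun x => mul_nonneg (hq _) (conditional_nonneg hp0 _ _))
      (fun x hx => mul_ne_zero (hsupp _ (marginal_B_ne_zero hp0 hx))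
        (div_ne_zero (marginal_BE_ne_zero hp0 hx) (marginal_B_ne_zero hp0 hx)))
      (by simp only [Fintype.sum_prod_type])]
  simp only [Fintype.sum_prod_type, Finset.mul_sum]
  rw [Finset.sum_comm]
  refine Finset.sum_congr rfl fun b _ => Finset.sum_congr rfl fun a _ =>
    Finset.sum_congr rfl fun e _ => ?_
  rw [Real.mul_rpow (hq b) (conditional_nonneg hp0 b e)]
  ring

/-- Each summand of the closed form is `blockSum` to the power `1 / α`. -/
theorem marginal_mul_rpow_eq_blockSum_rpow (hp0 : ∀ a c b e, 0 ≤ p a c b e) {α : ℝ}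
    (hα : 1 < α) (f : C → ℝ) (b : B) :
    (∑ a, ∑ c, ∑ e, p a c b e) *
      (∑ c, ((∑ a, ∑ e, p a c b e) / (∑ a, ∑ c', ∑ e, p a c' b e)) ^ α *
        (2 : ℝ) ^ ((α - 1) *
          (Dalpha α (fun x : A × E => p x.1 c b x.2 / (∑ a, ∑ e, p a c b e))
              (fun x : A × E => (∑ a, ∑ c', p a c' b x.2) / (∑ a, ∑ c', ∑ e, p a c' b e))
            + f c))) ^ (1 / α : ℝ) = blockSum α f p b ^ (1 / α : ℝ) := by
  have hα0 : α ≠ 0 := by linarith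
  by_cases hb : (∑ a, ∑ c, ∑ e, p a c b e) = 0
  · have hS : blockSum α f p b = 0 := by
      by_contra h
      exact (blockSum_ne_zero_iff hp0 hα f b).1 h hb
    rw [hS, Real.zero_rpow (one_div_ne_zero hα0), hb, zero_mul]
  · have hpos := (marginal_B_nonneg hp0 b).lt_of_ne' hb
    have hsum : (∑ c, ((∑ a, ∑ e, p a c b e) / (∑ a, ∑ c', ∑ e, p a c' b e)) ^ α *
        (2 : ℝ) ^ ((α - 1) *
          (Dalpha α (fun x : A × E => p x.1 c b x.2 / (∑ a, ∑ e, p a c b e))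
              (fun x : A × E => (∑ a, ∑ c', p a c' b x.2) / (∑ a, ∑ c', ∑ e, p a c' b e))
            + f c))) = blockSum α f p b / (∑ a, ∑ c, ∑ e, p a c b e) ^ α := by
      rw [blockSum, Finset.sum_div]
      refine Finset.sum_congr rfl fun c _ => ?_
      rw [mul_add, Real.rpow_add two_pos, Real.div_rpow
        (Finset.sum_nonneg fun a _ => Finset.sum_nonneg fun e _ => hp0 a c b e) hpos.le,
        ← mul_assoc, div_mul_eq_mul_div,
        mass_rpow_mul_two_rpow_Dalpha hα (p := fun x : A × E => p x.1 c b x.2)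
          (fun x => hp0 _ _ _ _) (fun x => conditional_nonneg hp0 _ _)
          (fun x hx => div_ne_zero (marginal_BE_ne_zero hp0 hx) (marginal_B_ne_zero hp0 hx))
          (by simp only [Fintype.sum_prod_type])]
      simp only [Fintype.sum_prod_type]
      ring
    rw [hsum, Real.div_rpow (blockSum_nonneg hp0 α f b) (Real.rpow_nonneg hpos.le _),
      ← Real.rpow_mul hpos.le, mul_one_div_cancel hα0, Real.rpow_one, mul_div_cancel₀ _ hb]

end

/-- **closed form of the optimized `f`-weighted Rényi entropy.**
For a probability distribution `p` on `A × C × B × E`, `f ∈ ℝ^𝒞` and `α ∈ (1,∞)`,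
the supremum over probability distributions `q` on `B` with `supp(p_B) ⊆ supp(q)` of
`H_α^f(AC|BE)_{p|σ_q}`, with `σ_q(b,e) = q(b)·p_{E|B}(e|b)`, equals
`(α/(1−α))·log(Σ_b p_B(b)·(Σ_c p_{C|B}(c|b)^α·2^{(α−1)[D_α(p_{AE|C=c,B=b}‖1_A⊗p_{E|B=b}) + f_c]})^{1/α})`,
and the supremum is attained. -/
theorem stmt8 {A C B E : Type} [Fintype A] [Fintype C] [Fintype B] [Fintype E]
    (α : ℝ) (hα : 1 < α) (f : C → ℝ)
    (p : A → C → B → E → ℝ) (hp0 : ∀ a c b e, 0 ≤ p a c b e)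
    (hp1 : ∑ a, ∑ c, ∑ b, ∑ e, p a c b e = 1) :
    (∀ q : B → ℝ, (∀ b, 0 ≤ q b) → (∑ b, q b) = 1 →
      (∀ b, (∑ a, ∑ c, ∑ e, p a c b e) ≠ 0 → q b ≠ 0) →
      Hf α f p (fun b e => q b * ((∑ a, ∑ c, p a c b e) / (∑ a, ∑ c, ∑ e', p a c b e'))) ≤
        (α / (1 - α)) * Real.logb 2
          (∑ b, (∑ a, ∑ c, ∑ e, p a c b e) *
            (∑ c, ((∑ a, ∑ e, p a c b e) / (∑ a, ∑ c', ∑ e, p a c' b e)) ^ α *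
              (2 : ℝ) ^ ((α - 1) *
                (Dalpha α (fun x : A × E => p x.1 c b x.2 / (∑ a, ∑ e, p a c b e))
                    (fun x : A × E => (∑ a, ∑ c', p a c' b x.2) / (∑ a, ∑ c', ∑ e, p a c' b e))
                  + f c))) ^ (1 / α : ℝ))) ∧
    (∃ q : B → ℝ, (∀ b, 0 ≤ q b) ∧ (∑ b, q b) = 1 ∧
      (∀ b, (∑ a, ∑ c, ∑ e, p a c b e) ≠ 0 → q b ≠ 0) ∧
      Hf α f p (fun b e => q b * ((∑ a, ∑ c, p a c b e) / (∑ a, ∑ c, ∑ e', p a c b e'))) =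
        (α / (1 - α)) * Real.logb 2
          (∑ b, (∑ a, ∑ c, ∑ e, p a c b e) *
            (∑ c, ((∑ a, ∑ e, p a c b e) / (∑ a, ∑ c', ∑ e, p a c' b e)) ^ α *
              (2 : ℝ) ^ ((α - 1) *
                (Dalpha α (fun x : A × E => p x.1 c b x.2 / (∑ a, ∑ e, p a c b e))
                    (fun x : A × E => (∑ a, ∑ c', p a c' b x.2) / (∑ a, ∑ c', ∑ e, p a c' b e))
                  + f c))) ^ (1 / α : ℝ))) := by
  have hα0 : α ≠ 0 := by linarith
  simp only [marginal_mul_rpow_eq_blockSum_rpow hp0 hα f]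
  have hS := blockSum_nonneg hp0 α f
  have hsuppS := fun b => (blockSum_ne_zero_iff hp0 hα f b).1
  have hZ : 0 < ∑ b, blockSum α f p b ^ (1 / α) := by
    obtain ⟨b, hb⟩ : ∃ b, (∑ a, ∑ c, ∑ e, p a c b e) ≠ 0 := by
      by_contra! h
      have hz : ∀ a c b e, p a c b e = 0 := fun a c b e => by
        by_contra h'
        exact marginal_B_ne_zero hp0 h' (h b)
      simp [hz] at hp1
    exact Finset.sum_pos' (fun b _ => Real.rpow_nonneg (hS b) _) ⟨b, Finset.mem_univ b,
      Real.rpow_pos_of_pos ((hS b).lt_of_ne' ((blockSum_ne_zero_iff hp0 hα f b).2 hb)) _⟩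
  have hlog : (α / (1 - α)) * Real.logb 2 (∑ b, blockSum α f p b ^ (1 / α)) =
      (1 / (1 - α)) * Real.logb 2 ((∑ b, blockSum α f p b ^ (1 / α)) ^ α) := by
    rw [Real.logb_rpow_eq_mul_logb_of_pos hZ]
    ring
  rw [hlog]
  constructor
  · intro q hq hq1 hsupp
    rw [Hf_eq_logb_sum_blockSum hp0 hα f hq hsupp]
    refine mul_le_mul_of_nonpos_left (Real.logb_le_logb_of_le (by norm_num)
      (Real.rpow_pos_of_pos hZ _) ?_) (one_div_nonpos.2 (by linarith))
    exact sum_rpow_inv_rpow_le hα hq hq1 hS fun b h => hsupp b (hsuppS b h)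
  · have hq : ∀ b, 0 ≤ blockSum α f p b ^ (1 / α) / ∑ b', blockSum α f p b' ^ (1 / α) :=
      fun b => div_nonneg (Real.rpow_nonneg (hS b) _) hZ.le
    have hsupp : ∀ b, (∑ a, ∑ c, ∑ e, p a c b e) ≠ 0 →
        blockSum α f p b ^ (1 / α) / ∑ b', blockSum α f p b' ^ (1 / α) ≠ 0 := fun b hb =>
      div_ne_zero (Real.rpow_pos_of_pos
        ((hS b).lt_of_ne' ((blockSum_ne_zero_iff hp0 hα f b).2 hb)) _).ne' hZ.ne'
    refine ⟨_, hq, ?_, hsupp, ?_⟩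
    · rw [← Finset.sum_div, div_self hZ.ne']
    · rw [Hf_eq_logb_sum_blockSum hp0 hα f hq hsupp, sum_normalized_rpow_mul hα hS hZ]
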